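/- Suppose n = 2^m − 1, so that S_n = F. Then the vanishing ideal I(Z_ns^×) ⊆ F[z₁, z₂] of the finite set of points Z_ns^× = F² \ {(c,c) : c ∈ F, c ≠ 0} is generated by the three polynomials z₁^{n+1} − z₁, z₁·((z₂ − z₁)^n − 1), and z₂^{n+1} − z₂; moreover, the common zero set of these three polynomials is exactly Z_ns^×. -/

import Mathlib

open MvPolynomial

theorem FiniteField.prod_X_sub_C_eq (K : Type*) [Field K] [Fintype K] :
    ∏ a : K, (Polynomial.X - Polynomial.C a) = Polynomial.X ^ Fintype.card K - Polynomial.X := by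
  have hcard : 1 < Fintype.card K := Fintype.one_lt_card
  have hmonic : (Polynomial.X ^ Fintype.card K - Polynomial.X : Polynomial K).Monic :=
    Polynomial.monic_X_pow_sub (by rw [Polynomial.degree_X]; exact_mod_cast hcard)
  have h := Polynomial.prod_multiset_X_sub_C_of_monic_of_roots_card_eq hmonic
    (by rw [FiniteField.roots_X_pow_card_sub_X,
          FiniteField.X_pow_card_sub_X_natDegree_eq K hcard]; rfl)
  rwa [FiniteField.roots_X_pow_card_sub_X] at h

theorem MvPolynomial.prod_X_sub_C_eq {σ K : Type*} [Field K] [Fintype K] (i : σ) :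
    ∏ a : K, (X i - C a : MvPolynomial σ K) = X i ^ Fintype.card K - X i := by
  simpa [map_prod, MvPolynomial.algebraMap_eq] using
    congrArg (Polynomial.aeval (X i : MvPolynomial σ K)) (FiniteField.prod_X_sub_C_eq K)

/-- A polynomial over a finite field that vanishes everywhere lies in the ideal generated by the
field equations. -/
theorem MvPolynomial.mem_span_X_pow_card_sub_X {σ K : Type*} [Finite σ] [Field K] [Fintype K]
    (f : MvPolynomial σ K) (hf : ∀ x, eval x f = 0) :
    f ∈ Ideal.span (Set.range fun i : σ ↦ (X i : MvPolynomial σ K) ^ Fintype.card K - X i) := by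
  obtain ⟨h, -, rfl⟩ := combinatorial_nullstellensatz_exists_linearCombination
    (fun _ : σ ↦ (Finset.univ : Finset K)) (fun _ ↦ Finset.univ_nonempty) f (fun x _ ↦ hf x)
  simp only [prod_X_sub_C_eq, Finsupp.linearCombination_apply]
  exact Submodule.sum_mem _ fun i _ ↦
    Submodule.smul_mem _ _ (Ideal.subset_span (Set.mem_range_self i))

/-- for `n = 2^m - 1` (so `S_n = F`), the vanishing ideal of
`Z_ns^× = F² \ {(c,c) : c ≠ 0}` is generated by the three polynomials
`z₁^{n+1} - z₁`, `z₁·((z₂ - z₁)^n - 1)` and `z₂^{n+1} - z₂`; moreover the common zero set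
of these three polynomials is exactly `Z_ns^×`. -/
theorem stmt_8 (m n : ℕ) (hm : 1 ≤ m) (hn : n = 2 ^ m - 1) :
    (∀ f : MvPolynomial (Fin 2) (GaloisField 2 m),
      f ∈ Ideal.span {(X 0 : MvPolynomial (Fin 2) (GaloisField 2 m)) ^ (n + 1) - X 0,
          X 0 * (((X 1 : MvPolynomial (Fin 2) (GaloisField 2 m)) - X 0) ^ n - 1),
          (X 1 : MvPolynomial (Fin 2) (GaloisField 2 m)) ^ (n + 1) - X 1} ↔
        ∀ p : GaloisField 2 m × GaloisField 2 m,
          ¬(p.1 = p.2 ∧ p.1 ≠ 0) → eval ![p.1, p.2] f = 0) ∧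
    ({p : GaloisField 2 m × GaloisField 2 m |
        eval ![p.1, p.2] ((X 0 : MvPolynomial (Fin 2) (GaloisField 2 m)) ^ (n + 1) - X 0) = 0 ∧
        eval ![p.1, p.2]
          ((X 0 : MvPolynomial (Fin 2) (GaloisField 2 m)) * ((X 1 - X 0) ^ n - 1)) = 0 ∧
        eval ![p.1, p.2] ((X 1 : MvPolynomial (Fin 2) (GaloisField 2 m)) ^ (n + 1) - X 1) = 0}
      = {p : GaloisField 2 m × GaloisField 2 m | ¬(p.1 = p.2 ∧ p.1 ≠ 0)}) := by
  have : Fintype (GaloisField 2 m) := Fintype.ofFinite _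
  have hn0 : n ≠ 0 := by
    have := Nat.one_lt_two_pow (n := m) (by omega)
    omega
  have hcard : Fintype.card (GaloisField 2 m) = n + 1 := by
    rw [Fintype.card_eq_nat_card, GaloisField.card 2 m (by omega)]
    have := Nat.one_lt_two_pow (n := m) (by omega)
    omega
  have hfield (a : GaloisField 2 m) : a ^ (n + 1) = a := by
    rw [← hcard, FiniteField.pow_card]
  have hunit (a : GaloisField 2 m) (ha : a ≠ 0) : a ^ n = 1 := by
    have := FiniteField.pow_card_sub_one_eq_one a ha
    rwa [hcard, Nat.add_sub_cancel] at this
  have hzero (p : GaloisField 2 m × GaloisField 2 m) :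
      p.1 * ((p.2 - p.1) ^ n - 1) = 0 ↔ ¬(p.1 = p.2 ∧ p.1 ≠ 0) := by
    by_cases h : p.1 = p.2
    · simp [h, hn0]
    · simp [h, hunit _ (sub_ne_zero.mpr (Ne.symm h))]
  refine ⟨fun f ↦ ⟨fun hf p hp ↦ ?_, fun hf ↦ ?_⟩, ?_⟩
  · rw [← RingHom.mem_ker]
    refine Ideal.span_le.mpr ?_ hf
    rintro g (rfl | rfl | rfl)
    · simp [RingHom.mem_ker, hfield]
    · simpa [RingHom.mem_ker] using (hzero p).mpr hp
    · simp [RingHom.mem_ker, hfield]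
  · set g : MvPolynomial (Fin 2) (GaloisField 2 m) := X 0 * ((X 1 - X 0) ^ n - 1) with hg
    set I := Ideal.span {(X 0 : MvPolynomial (Fin 2) (GaloisField 2 m)) ^ (n + 1) - X 0, g,
      X 1 ^ (n + 1) - X 1}
    have hgI : g ∈ I := Ideal.subset_span (by simp)
    have hvanish : f + f * X 0 ^ (n - 1) * g ∈ I := by
      refine Ideal.span_le.mpr ?_
        (mem_span_X_pow_card_sub_X (f + f * X 0 ^ (n - 1) * g) fun x ↦ ?_)
      · rintro _ ⟨i, rfl⟩
        rw [hcard]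
        fin_cases i <;> exact Ideal.subset_span (by simp)
      · by_cases hx : x 0 = x 1 ∧ x 0 ≠ 0
        · have hpow : x 0 ^ (n - 1) * x 0 = 1 := by
            rw [pow_sub_one_mul hn0, hunit _ hx.2]
          simp only [hg, map_add, map_mul, map_sub, map_pow, map_one, eval_X, ← hx.1, sub_self,
            zero_pow hn0]
          linear_combination -eval x f * hpow
        · have hfx : eval x f = 0 := by
            have hx' : x = ![x 0, x 1] := by ext i; fin_cases i <;> rfl
            rw [hx']
            exact hf (x 0, x 1) hx
          simp [hfx]
    exact (Ideal.add_mem_iff_left I (I.mul_mem_left _ hgI)).mp hvanish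
  · ext p
    simpa [hfield] using hzero p
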